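/- Let P₁ = (X₁, Y₁) and P₂ = (X₂, Y₂) be two independent points, each uniformly distributed in the square [0, ℓ]². Then the Euclidean distance T = ‖P₁ - P₂‖ has probability density f_{T,ℓ}(t) = (4t/ℓ⁴)(πℓ²/2 - 2ℓt + t²/2) for t ∈ [0, ℓ], and f_{T,ℓ}(t) = (4t/ℓ⁴)(ℓ²·arcsin((2ℓ² - t²)/t²) + 2ℓ√(t² - ℓ²) - ℓ² - t²/2) for t ∈ [ℓ, √2·ℓ], and 0 otherwise. -/

import Mathlib

open MeasureTheory ProbabilityTheory Real

/-- The density `f_{T,ℓ}` of the distance between two independent uniform points in a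
square of side `ℓ`. -/
noncomputable def fTL (ℓ t : ℝ) : ℝ :=
  if t ∈ Set.Icc 0 ℓ then
    4 * t / ℓ ^ 4 * (Real.pi * ℓ ^ 2 / 2 - 2 * ℓ * t + t ^ 2 / 2)
  else if t ∈ Set.Icc ℓ (Real.sqrt 2 * ℓ) then
    4 * t / ℓ ^ 4 *
      (ℓ ^ 2 * Real.arcsin ((2 * ℓ ^ 2 - t ^ 2) / t ^ 2) +
        2 * ℓ * Real.sqrt (t ^ 2 - ℓ ^ 2) - ℓ ^ 2 - t ^ 2 / 2)
  else 0

/-- The angular integrand of the distance density at radius `r`: the triangular densities of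
the coordinate differences, up to normalization, evaluated at `(r cos θ, r sin θ)`. -/
noncomputable def angularIntegrand (ℓ r θ : ℝ) : ℝ :=
  max (ℓ - |r * cos θ|) 0 * max (ℓ - |r * sin θ|) 0

lemma continuous_angularIntegrand (ℓ r : ℝ) : Continuous (angularIntegrand ℓ r) := by
  unfold angularIntegrand
  fun_prop

lemma angularIntegrand_nonneg (ℓ r θ : ℝ) : 0 ≤ angularIntegrand ℓ r θ :=
  mul_nonneg (le_max_right _ _) (le_max_right _ _)

lemma angularIntegrand_periodic (ℓ r : ℝ) :
    Function.Periodic (angularIntegrand ℓ r) (π / 2) := by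
  intro θ
  simp only [angularIntegrand, cos_add_pi_div_two, sin_add_pi_div_two, mul_neg, abs_neg]
  exact mul_comm _ _

lemma integral_angularIntegrand (ℓ r : ℝ) :
    ∫ θ in (-π)..π, angularIntegrand ℓ r θ = 4 * ∫ θ in 0..(π / 2), angularIntegrand ℓ r θ := by
  have hp := angularIntegrand_periodic ℓ r
  have h := hp.intervalIntegral_add_zsmul_eq 4 (-π)
    (fun _ _ => (continuous_angularIntegrand ℓ r).intervalIntegrable _ _)
  have h4 : -π + (4 : ℤ) • (π / 2) = π := by
    simp only [zsmul_eq_mul]; push_cast; ring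
  rw [h4, hp.intervalIntegral_add_eq (-π) 0, zero_add] at h
  simpa using h

lemma integral_mul_cos_sin (ℓ r a b : ℝ) :
    ∫ θ in a..b, (ℓ - r * cos θ) * (ℓ - r * sin θ) =
      (ℓ ^ 2 * b - ℓ * r * sin b + ℓ * r * cos b + r ^ 2 * sin b ^ 2 / 2) -
      (ℓ ^ 2 * a - ℓ * r * sin a + ℓ * r * cos a + r ^ 2 * sin a ^ 2 / 2) := by
  refine intervalIntegral.integral_eq_sub_of_hasDerivAt
    (f := fun θ => ℓ ^ 2 * θ - ℓ * r * sin θ + ℓ * r * cos θ + r ^ 2 * sin θ ^ 2 / 2)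
    (fun θ _ => ?_) (Continuous.intervalIntegrable (by fun_prop) _ _)
  have h := ((((hasDerivAt_id θ).const_mul (ℓ ^ 2)).sub ((hasDerivAt_sin θ).const_mul (ℓ * r))).add
    ((hasDerivAt_cos θ).const_mul (ℓ * r))).add
    ((((hasDerivAt_sin θ).pow 2).const_mul (r ^ 2)).div_const 2)
  refine h.congr_deriv ?_
  simp
  ring

lemma angularIntegrand_eq {ℓ r θ : ℝ} (hr : 0 ≤ r) (h0 : 0 ≤ θ) (h1 : θ ≤ π / 2)
    (hc : r * cos θ ≤ ℓ) (hs : r * sin θ ≤ ℓ) :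
    angularIntegrand ℓ r θ = (ℓ - r * cos θ) * (ℓ - r * sin θ) := by
  have hcos : 0 ≤ r * cos θ := mul_nonneg hr (cos_nonneg_of_mem_Icc ⟨by linarith, h1⟩)
  have hsin : 0 ≤ r * sin θ := mul_nonneg hr (sin_nonneg_of_mem_Icc ⟨h0, by linarith [pi_pos]⟩)
  rw [angularIntegrand, abs_of_nonneg hcos, abs_of_nonneg hsin, max_eq_left (by linarith),
    max_eq_left (by linarith)]

lemma angularIntegrand_eq_zero {ℓ r θ : ℝ} (h : ℓ ≤ r * cos θ ∨ ℓ ≤ r * sin θ) :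
    angularIntegrand ℓ r θ = 0 := by
  rcases h with h | h
  · rw [angularIntegrand, max_eq_right (by linarith [le_abs_self (r * cos θ)]), zero_mul]
  · rw [angularIntegrand, max_eq_right (a := ℓ - |r * sin θ|)
      (by linarith [le_abs_self (r * sin θ)]), mul_zero]

lemma quarter_integral_of_le {ℓ r : ℝ} (hr : 0 ≤ r) (hrl : r ≤ ℓ) :
    ∫ θ in 0..(π / 2), angularIntegrand ℓ r θ = π * ℓ ^ 2 / 2 - 2 * ℓ * r + r ^ 2 / 2 := by
  have h : ∫ θ in 0..(π / 2), angularIntegrand ℓ r θ =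
      ∫ θ in 0..(π / 2), (ℓ - r * cos θ) * (ℓ - r * sin θ) := by
    refine intervalIntegral.integral_congr fun θ hθ => ?_
    rw [Set.uIcc_of_le (by positivity)] at hθ
    exact angularIntegrand_eq hr hθ.1 hθ.2 (by nlinarith [cos_le_one θ])
      (by nlinarith [sin_le_one θ])
  rw [h, integral_mul_cos_sin]
  simp
  ring

lemma quarter_integral_of_mem {ℓ r : ℝ} (hℓ : 0 < ℓ) (hlr : ℓ ≤ r) (hr2 : r ≤ √2 * ℓ) :
    ∫ θ in 0..(π / 2), angularIntegrand ℓ r θ =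
      ℓ ^ 2 * arcsin ((2 * ℓ ^ 2 - r ^ 2) / r ^ 2) + 2 * ℓ * √(r ^ 2 - ℓ ^ 2) - ℓ ^ 2
        - r ^ 2 / 2 := by
  have hr : 0 < r := hℓ.trans_le hlr
  set b := arcsin (ℓ / r) with hb
  set a := π / 2 - b with ha
  have hx0 : 0 < ℓ / r := by positivity
  have hx1 : ℓ / r ≤ 1 := (div_le_one hr).2 hlr
  have hsinb : sin b = ℓ / r := sin_arcsin (by linarith) hx1
  have hb0 : 0 ≤ b := arcsin_nonneg.2 hx0.le
  have hb1 : b ≤ π / 2 := arcsin_le_pi_div_two _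
  have hb4 : π / 4 ≤ b := by
    rw [hb, pi_div_four_le_arcsin, div_le_div_iff₀ (by norm_num) hr]
    have h2 : √2 * √2 = 2 := mul_self_sqrt (by norm_num)
    nlinarith [sqrt_nonneg 2]
  have hab : a ≤ b := by linarith
  have ha0 : 0 ≤ a := by linarith
  have hrsinb : r * sin b = ℓ := by rw [hsinb]; field_simp
  have hrcosb : r * cos b = √(r ^ 2 - ℓ ^ 2) := by
    rw [hb, cos_arcsin, ← sqrt_sq hr.le, ← sqrt_mul (by positivity), sqrt_sq hr.le]
    congr 1
    field_simp
  have hcosa : cos a = sin b := cos_pi_div_two_sub b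
  have hsina : sin a = cos b := sin_pi_div_two_sub b
  have hii : ∀ x y, IntervalIntegrable (angularIntegrand ℓ r) volume x y := fun _ _ =>
    (continuous_angularIntegrand ℓ r).intervalIntegrable _ _
  have h1 : ∫ θ in 0..a, angularIntegrand ℓ r θ = 0 := by
    refine (intervalIntegral.integral_congr fun θ hθ => ?_).trans intervalIntegral.integral_zero
    rw [Set.uIcc_of_le ha0] at hθ
    refine angularIntegrand_eq_zero (Or.inl ?_)
    have := cos_le_cos_of_nonneg_of_le_pi hθ.1 (by linarith [pi_pos]) hθ.2
    nlinarith
  have h3 : ∫ θ in b..(π / 2), angularIntegrand ℓ r θ = 0 := by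
    refine (intervalIntegral.integral_congr fun θ hθ => ?_).trans intervalIntegral.integral_zero
    rw [Set.uIcc_of_le hb1] at hθ
    refine angularIntegrand_eq_zero (Or.inr ?_)
    have := sin_le_sin_of_le_of_le_pi_div_two (by linarith [pi_pos]) hθ.2 hθ.1
    nlinarith
  have h2 : ∫ θ in a..b, angularIntegrand ℓ r θ =
      ∫ θ in a..b, (ℓ - r * cos θ) * (ℓ - r * sin θ) := by
    refine intervalIntegral.integral_congr fun θ hθ => ?_
    rw [Set.uIcc_of_le hab] at hθ
    have hc := cos_le_cos_of_nonneg_of_le_pi ha0 (by linarith [pi_pos, hθ.2]) hθ.1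
    have hs := sin_le_sin_of_le_of_le_pi_div_two (by linarith [hθ.1, pi_pos]) hb1 hθ.2
    exact angularIntegrand_eq hr.le (ha0.trans hθ.1) (hθ.2.trans hb1) (by nlinarith)
      (by nlinarith)
  have harc : arcsin ((2 * ℓ ^ 2 - r ^ 2) / r ^ 2) = 2 * b - π / 2 := by
    refine arcsin_eq_of_sin_eq ?_ ⟨by linarith, by linarith⟩
    rw [sin_sub_pi_div_two, cos_two_mul, cos_sq', hsinb]
    field_simp
    ring
  have hcos2 : √(r ^ 2 - ℓ ^ 2) ^ 2 = r ^ 2 - ℓ ^ 2 := sq_sqrt (by nlinarith)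
  rw [← intervalIntegral.integral_add_adjacent_intervals (hii 0 a) (hii a _),
    ← intervalIntegral.integral_add_adjacent_intervals (hii a b) (hii b _), h1, h2, h3,
    integral_mul_cos_sin, hcosa, hsina, harc, ← hrcosb]
  rw [← hrcosb] at hcos2
  linear_combination (-2 * ℓ + (r * sin b + ℓ) / 2) * hrsinb - hcos2 / 2

lemma quarter_integral_of_lt {ℓ r : ℝ} (hℓ : 0 < ℓ) (hr2 : √2 * ℓ < r) :
    ∫ θ in 0..(π / 2), angularIntegrand ℓ r θ = 0 := by
  refine (intervalIntegral.integral_congr fun θ hθ => ?_).trans intervalIntegral.integral_zero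
  rw [Set.uIcc_of_le (by positivity)] at hθ
  refine angularIntegrand_eq_zero ?_
  by_contra! h
  have hr : 0 < r := lt_of_le_of_lt (by positivity) hr2
  have hc := mul_nonneg hr.le (cos_nonneg_of_mem_Icc ⟨by linarith [hθ.1, pi_pos], hθ.2⟩)
  have hs := mul_nonneg hr.le (sin_nonneg_of_mem_Icc ⟨hθ.1, by linarith [hθ.2, pi_pos]⟩)
  have h1 : (√2 * ℓ) ^ 2 < r ^ 2 := pow_lt_pow_left₀ hr2 (by positivity) two_ne_zero
  rw [mul_pow, sq_sqrt (by norm_num)] at h1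
  have h2 : r ^ 2 = (r * cos θ) ^ 2 + (r * sin θ) ^ 2 := by
    linear_combination -r ^ 2 * sin_sq_add_cos_sq θ
  nlinarith [h.1, h.2]

lemma mul_integral_angularIntegrand {ℓ r : ℝ} (hℓ : 0 < ℓ) (hr : 0 < r) :
    r * ∫ θ in (-π)..π, angularIntegrand ℓ r θ = ℓ ^ 4 * fTL ℓ r := by
  rw [integral_angularIntegrand, fTL]
  split_ifs with h1 h2
  · rw [quarter_integral_of_le h1.1 h1.2]
    field_simp
  · rw [quarter_integral_of_mem hℓ h2.1 h2.2]
    field_simp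
  · have hlr : ℓ < r := by
      by_contra! h
      exact h1 ⟨hr.le, h⟩
    rw [quarter_integral_of_lt hℓ (by
      by_contra! h
      exact h2 ⟨hlr.le, h⟩)]
    simp

lemma lintegral_angular {ℓ r : ℝ} (hℓ : 0 < ℓ) (hr : 0 < r) :
    ENNReal.ofReal r * ∫⁻ θ in Set.Ioo (-π) π,
      ENNReal.ofReal (ℓ - |r * cos θ|) * ENNReal.ofReal (ℓ - |r * sin θ|) =
    ENNReal.ofReal (ℓ ^ 4) * ENNReal.ofReal (fTL ℓ r) := by
  have hmax : ∀ x : ℝ, ENNReal.ofReal x = ENNReal.ofReal (max x 0) := fun x => by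
    rcases le_total x 0 with h | h <;> simp [h, ENNReal.ofReal_of_nonpos]
  have h : ∀ θ, ENNReal.ofReal (ℓ - |r * cos θ|) * ENNReal.ofReal (ℓ - |r * sin θ|) =
      ENNReal.ofReal (angularIntegrand ℓ r θ) := fun θ => by
    rw [angularIntegrand, ENNReal.ofReal_mul (le_max_right _ _), ← hmax, ← hmax]
  simp_rw [h]
  rw [Measure.restrict_congr_set Ioo_ae_eq_Ioc, ← ofReal_integral_eq_lintegral_ofReal
    ((continuous_angularIntegrand ℓ r).integrableOn_Ioc)
    (ae_of_all _ (angularIntegrand_nonneg ℓ r)),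
    ← intervalIntegral.integral_of_le (by linarith [pi_pos]), ← ENNReal.ofReal_mul hr.le,
    ← ENNReal.ofReal_mul (by positivity), mul_integral_angularIntegrand hℓ hr]

lemma fTL_of_neg {ℓ t : ℝ} (hℓ : 0 < ℓ) (ht : t < 0) : fTL ℓ t = 0 := by
  rw [fTL, if_neg fun h => ht.not_ge h.1, if_neg fun h => (ht.trans hℓ).not_ge h.1]

lemma lintegral_lintegral_sub {G : Type*} [AddGroup G] [MeasurableSpace G] [MeasurableAdd₂ G]
    [MeasurableSub₂ G]
    (μ : Measure G) [SFinite μ] [μ.IsAddRightInvariant] {S : Set G} (hS : MeasurableSet S)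
    {h : G → ENNReal} (hh : Measurable h) :
    ∫⁻ p in S, ∫⁻ q in S, h (p - q) ∂μ ∂μ = ∫⁻ d, h d * μ ({q | d + q ∈ S} ∩ S) ∂μ := by
  have hm : Measurable (Function.uncurry fun p q => h (p - q)) := by
    dsimp only [Function.uncurry_def]; fun_prop
  rw [lintegral_lintegral_swap hm.aemeasurable]
  have h1 : ∀ q, ∫⁻ p in S, h (p - q) ∂μ = ∫⁻ d, S.indicator 1 (d + q) * h d ∂μ := fun q => by
    rw [← lintegral_indicator hS, ← lintegral_add_right_eq_self _ q]
    refine lintegral_congr fun d => ?_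
    by_cases hd : d + q ∈ S <;> simp [hd]
  simp_rw [h1]
  have hS1 : Measurable (S.indicator (1 : G → ENNReal)) := measurable_one.indicator hS
  rw [lintegral_lintegral_swap (by dsimp only [Function.uncurry_def]; fun_prop)]
  refine lintegral_congr fun d => ?_
  have hdS : MeasurableSet {q | d + q ∈ S} := (measurable_const_add d) hS
  rw [lintegral_mul_const _ (by fun_prop), mul_comm]
  congr 1
  have h2 : (fun q => S.indicator (1 : G → ENNReal) (d + q)) = {q | d + q ∈ S}.indicator 1 := rfl
  rw [h2, lintegral_indicator_one hdS, Measure.restrict_apply hdS]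

lemma volume_Icc_inter_translate (ℓ d : ℝ) :
    volume ({q | d + q ∈ Set.Icc 0 ℓ} ∩ Set.Icc 0 ℓ) = ENNReal.ofReal (ℓ - |d|) := by
  have h : {q | d + q ∈ Set.Icc 0 ℓ} ∩ Set.Icc 0 ℓ = Set.Icc (max (-d) 0) (min (ℓ - d) ℓ) := by
    ext q
    simp only [Set.mem_inter_iff, Set.mem_ofPred_eq, Set.mem_Icc, max_le_iff, le_min_iff]
    constructor <;> rintro ⟨⟨_, _⟩, _, _⟩ <;> refine ⟨⟨?_, ?_⟩, ?_, ?_⟩ <;> linarith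
  rw [h, Real.volume_Icc]
  congr 1
  rcases le_total d 0 with hd | hd
  · rw [abs_of_nonpos hd, max_eq_left (by linarith), min_eq_right (by linarith)]
  · rw [abs_of_nonneg hd, max_eq_right (by linarith), min_eq_left (by linarith)]
    ring

lemma volume_square_inter_translate (ℓ : ℝ) (d : ℝ × ℝ) :
    volume ({q | d + q ∈ Set.Icc 0 ℓ ×ˢ Set.Icc 0 ℓ} ∩ Set.Icc 0 ℓ ×ˢ Set.Icc 0 ℓ) =
      ENNReal.ofReal (ℓ - |d.1|) * ENNReal.ofReal (ℓ - |d.2|) := by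
  rw [← volume_Icc_inter_translate, ← volume_Icc_inter_translate, ← Measure.prod_prod]
  congr 1
  ext q
  simp only [Set.mem_inter_iff, Set.mem_ofPred_eq, Set.mem_prod, Prod.fst_add, Prod.snd_add]
  tauto

lemma lintegral_radial {ℓ : ℝ} (hℓ : 0 < ℓ) {g : ℝ → ENNReal} (hg : Measurable g) :
    ∫⁻ d : ℝ × ℝ, g √(d.1 ^ 2 + d.2 ^ 2) *
      (ENNReal.ofReal (ℓ - |d.1|) * ENNReal.ofReal (ℓ - |d.2|)) =
    ENNReal.ofReal (ℓ ^ 4) * ∫⁻ t, g t * ENNReal.ofReal (fTL ℓ t) := by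
  rw [← lintegral_comp_polarCoord_symm]
  simp only [polarCoord_target, polarCoord_symm_apply, smul_eq_mul]
  rw [Measure.volume_eq_prod, ← Measure.prod_restrict, lintegral_prod _ (by fun_prop),
    ← lintegral_const_mul' _ _ ENNReal.ofReal_ne_top,
    ← lintegral_indicator measurableSet_Ioi]
  refine lintegral_congr_ae ?_
  filter_upwards [Measure.ae_ne volume (0 : ℝ)] with r hr0
  rcases lt_or_gt_of_ne hr0 with hr | hr
  · rw [Set.indicator_of_notMem (by simpa using hr.le), fTL_of_neg hℓ hr]
    simp
  rw [Set.indicator_of_mem (Set.mem_Ioi.2 hr), mul_left_comm, ← lintegral_angular hℓ hr,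
    ← mul_assoc, ← lintegral_const_mul _ (by fun_prop)]
  refine lintegral_congr fun θ => ?_
  have : √((r * cos θ) ^ 2 + (r * sin θ) ^ 2) = r := by
    rw [show (r * cos θ) ^ 2 + (r * sin θ) ^ 2 = r ^ 2 by
      linear_combination r ^ 2 * sin_sq_add_cos_sq θ, sqrt_sq hr.le]
  rw [this]
  ring

/-- If `P₁ = (X₁,Y₁)` and `P₂ = (X₂,Y₂)` are independent points, each uniform in the square
`[0,ℓ]²`, then the Euclidean distance `T = ‖P₁ - P₂‖` has probability density `f_{T,ℓ}`. -/
theorem stmt_4 {Ω : Type*} [MeasurableSpace Ω] (P : Measure Ω) [IsProbabilityMeasure P]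
    (ℓ : ℝ) (hℓ : 0 < ℓ) (P₁ P₂ : Ω → ℝ × ℝ) (hP₁ : Measurable P₁) (hP₂ : Measurable P₂)
    (hindep : IndepFun P₁ P₂ P)
    (hu₁ : pdf.IsUniform P₁ (Set.Icc 0 ℓ ×ˢ Set.Icc 0 ℓ) P volume)
    (hu₂ : pdf.IsUniform P₂ (Set.Icc 0 ℓ ×ˢ Set.Icc 0 ℓ) P volume) :
    P.map (fun ω =>
        Real.sqrt (((P₁ ω).1 - (P₂ ω).1) ^ 2 + ((P₁ ω).2 - (P₂ ω).2) ^ 2)) =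
      volume.withDensity (fun t => ENNReal.ofReal (fTL ℓ t)) := by
  set S : Set (ℝ × ℝ) := Set.Icc 0 ℓ ×ˢ Set.Icc 0 ℓ with hS
  have hSm : MeasurableSet S := measurableSet_Icc.prod measurableSet_Icc
  have hvol : volume S = ENNReal.ofReal (ℓ ^ 2) := by
    rw [hS, Measure.volume_eq_prod, Measure.prod_prod, Real.volume_Icc, sub_zero,
      ← ENNReal.ofReal_mul hℓ.le, sq]
  have hjoint := hindep.map_prod_eq_prod_map_map hP₁.aemeasurable hP₂.aemeasurable
  rw [pdf.IsUniform] at hu₁ hu₂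
  rw [hu₁, hu₂, ProbabilityTheory.cond] at hjoint
  refine Measure.ext_of_lintegral _ fun g hg => ?_
  have hdist : Measurable fun d : ℝ × ℝ => √(d.1 ^ 2 + d.2 ^ 2) := by fun_prop
  have hfTL : Measurable (fTL ℓ) := by
    unfold fTL
    exact Measurable.ite measurableSet_Icc (by fun_prop)
      (Measurable.ite measurableSet_Icc (by fun_prop) measurable_const)
  have hl4 : (volume S)⁻¹ * ((volume S)⁻¹ * ENNReal.ofReal (ℓ ^ 4)) = 1 := by
    have h0 : ENNReal.ofReal (ℓ ^ 2) ≠ 0 := by simpa using hℓ.ne'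
    rw [hvol, show ℓ ^ 4 = ℓ ^ 2 * ℓ ^ 2 by ring, ENNReal.ofReal_mul (by positivity),
      ENNReal.inv_mul_cancel_left h0 ENNReal.ofReal_ne_top,
      ENNReal.inv_mul_cancel h0 ENNReal.ofReal_ne_top]
  have hpair : ∫⁻ t, g t ∂P.map (fun ω =>
      √(((P₁ ω).1 - (P₂ ω).1) ^ 2 + ((P₁ ω).2 - (P₂ ω).2) ^ 2)) =
      ∫⁻ z : (ℝ × ℝ) × (ℝ × ℝ), g √((z.1 - z.2).1 ^ 2 + (z.1 - z.2).2 ^ 2)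
        ∂P.map (fun ω => (P₁ ω, P₂ ω)) := by
    rw [lintegral_map hg (by fun_prop), lintegral_map (by fun_prop) (by fun_prop)]
    rfl
  rw [hpair, hjoint, lintegral_prod _ (by fun_prop)]
  simp_rw [lintegral_smul_measure, smul_eq_mul]
  rw [lintegral_const_mul' _ _ (ENNReal.inv_ne_top.2 (by rw [hvol]; simpa using hℓ.ne'))]
  have hsub := lintegral_lintegral_sub volume hSm (hg.comp hdist)
  simp_rw [hS, volume_square_inter_translate, ← hS, Function.comp_apply] at hsub
  rw [hsub, lintegral_radial hℓ hg, ← mul_assoc, ← mul_assoc, mul_assoc (volume S)⁻¹, hl4, one_mul,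
    lintegral_withDensity_eq_lintegral_mul _ (by fun_prop) hg]
  exact lintegral_congr fun t => mul_comm _ _
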